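/- arXiv:2003.03649 — 2 statements merged into one kernel-verified Lean document; each statement's English description precedes it below -/
import Mathlib

section
/- Let C_0 > 0, C_1, …, C_m ≥ 0 and ε > 0, and define g(x_0, x_1, …, x_m) = x_0 / (C_0 + Σ_{k=1}^m C_k x_k + ε x_0) on the nonnegative orthant [0,∞)^{m+1}. Then g is Lipschitz continuous with respect to the ℓ¹ distance: for all x, x' in [0,∞)^{m+1}, |g(x) - g(x')| ≤ L · Σ_{k=0}^m |x_k - x'_k|, where L = max(1/C_0, max_{1≤k≤m} C_k/(ε C_0)). -/
/-- The two-variable estimate: `a / (S + ε * a)` varies by at most `|a - b| / c` in `a` and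
`|S - S'| / (ε * c)` in `S`, when `S` and `S'` are bounded below by `c`. -/
theorem abs_div_add_mul_sub_div_add_mul_le {c ε a b S S' : ℝ} (hc : 0 < c) (hε : 0 < ε)
    (ha : 0 ≤ a) (hb : 0 ≤ b) (hS : c ≤ S) (hS' : c ≤ S') :
    |a / (S + ε * a) - b / (S' + ε * b)| ≤ 1 / c * |a - b| + |S - S'| / (ε * c) := by
  have hεa : 0 ≤ ε * a := by positivity
  have hεb : 0 ≤ ε * b := by positivity
  have hD : 0 < S + ε * a := by linarith
  have hD' : 0 < S' + ε * b := by linarith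
  have hsplit : a / (S + ε * a) - b / (S' + ε * b) =
      S' / (S' + ε * b) * (1 / (S + ε * a)) * (a - b) +
        b / (S' + ε * b) * (1 / (S + ε * a)) * (S' - S) := by
    rw [div_sub_div _ _ hD.ne' hD'.ne', div_eq_mul_inv, mul_inv]
    ring
  have hinv : 1 / (S + ε * a) ≤ 1 / c := one_div_le_one_div_of_le hc (by linarith)
  have hS'_le : S' / (S' + ε * b) ≤ 1 := (div_le_one hD').2 (by linarith)
  have hb_le : b / (S' + ε * b) ≤ 1 / ε := by
    rw [div_le_div_iff₀ hD' hε]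
    linarith
  have hS'_nonneg : 0 ≤ S' / (S' + ε * b) := div_nonneg (by linarith) hD'.le
  have hb_nonneg : 0 ≤ b / (S' + ε * b) := div_nonneg hb hD'.le
  have hinv_nonneg : 0 ≤ 1 / (S + ε * a) := by positivity
  calc |a / (S + ε * a) - b / (S' + ε * b)|
      ≤ S' / (S' + ε * b) * (1 / (S + ε * a)) * |a - b| +
        b / (S' + ε * b) * (1 / (S + ε * a)) * |S' - S| := by
        rw [hsplit]
        refine (abs_add_le _ _).trans_eq ?_
        rw [abs_mul, abs_mul _ (S' - S), abs_of_nonneg (mul_nonneg hS'_nonneg hinv_nonneg),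
          abs_of_nonneg (mul_nonneg hb_nonneg hinv_nonneg)]
    _ ≤ 1 * (1 / c) * |a - b| + 1 / ε * (1 / c) * |S' - S| := by gcongr
    _ = 1 / c * |a - b| + |S - S'| / (ε * c) := by
        rw [abs_sub_comm S' S]
        field_simp

/-- Let `C 0 > 0`, `C 1, …, C m ≥ 0` and `ε > 0`, and define
`g x = x 0 / (C 0 + ∑_{k=1}^m C k * x k + ε * x 0)` on the nonnegative orthant
`[0, ∞)^{m+1}`. Then `g` is Lipschitz continuous with respect to the ℓ¹ distance:
`|g x - g x'| ≤ L * ∑_{k=0}^m |x k - x' k|` with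
`L = max (1 / C 0) (max_{1 ≤ k ≤ m} C k / (ε * C 0))`. -/
theorem transform_lipschitz (m : ℕ) (C : ℕ → ℝ) (ε : ℝ)
    (hC0 : 0 < C 0) (hC : ∀ k, 1 ≤ k → k ≤ m → 0 ≤ C k) (hε : 0 < ε)
    (x x' : ℕ → ℝ) (hx : ∀ k, k ≤ m → 0 ≤ x k) (hx' : ∀ k, k ≤ m → 0 ≤ x' k) :
    |x 0 / (C 0 + (∑ k ∈ Finset.Icc 1 m, C k * x k) + ε * x 0) -
      x' 0 / (C 0 + (∑ k ∈ Finset.Icc 1 m, C k * x' k) + ε * x' 0)| ≤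
    ((Finset.Icc 0 m).sup' (Finset.nonempty_Icc.mpr (Nat.zero_le m))
        (fun k => if k = 0 then 1 / C 0 else C k / (ε * C 0))) *
      ∑ k ∈ Finset.range (m + 1), |x k - x' k| := by
  have hS : ∀ y : ℕ → ℝ, (∀ k, k ≤ m → 0 ≤ y k) →
      C 0 ≤ C 0 + ∑ k ∈ Finset.Icc 1 m, C k * y k := fun y hy =>
    le_add_of_nonneg_right <| Finset.sum_nonneg fun k hk => by
      obtain ⟨h1, h2⟩ := Finset.mem_Icc.1 hk
      exact mul_nonneg (hC k h1 h2) (hy k h2)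
  refine (abs_div_add_mul_sub_div_add_mul_le hC0 hε (hx 0 m.zero_le) (hx' 0 m.zero_le)
    (hS x hx) (hS x' hx')).trans ?_
  set f : ℕ → ℝ := fun k => if k = 0 then 1 / C 0 else C k / (ε * C 0) with hf
  have hL : ∀ k ≤ m, f k ≤ (Finset.Icc 0 m).sup' (Finset.nonempty_Icc.mpr m.zero_le) f :=
    fun k hk => Finset.le_sup' f (Finset.mem_Icc.2 ⟨k.zero_le, hk⟩)
  have hsum : |(C 0 + ∑ k ∈ Finset.Icc 1 m, C k * x k) -
      (C 0 + ∑ k ∈ Finset.Icc 1 m, C k * x' k)| / (ε * C 0) ≤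
      ∑ k ∈ Finset.Icc 1 m, f k * |x k - x' k| := by
    rw [add_sub_add_left_eq_sub, ← Finset.sum_sub_distrib, div_le_iff₀ (by positivity),
      Finset.sum_mul]
    refine (Finset.abs_sum_le_sum_abs _ _).trans (Finset.sum_le_sum fun k hk => le_of_eq ?_)
    obtain ⟨h1, h2⟩ := Finset.mem_Icc.1 hk
    have hk0 : k ≠ 0 := by omega
    rw [← mul_sub, abs_mul, abs_of_nonneg (hC k h1 h2)]
    simp only [hf, if_neg hk0]
    field_simp
  have hrange : Finset.range (m + 1) = insert 0 (Finset.Icc 1 m) := by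
    ext k
    simp only [Finset.mem_range, Finset.mem_insert, Finset.mem_Icc]
    omega
  rw [hrange, Finset.sum_insert (by simp), mul_add, Finset.mul_sum]
  refine add_le_add (mul_le_mul_of_nonneg_right ?_ (abs_nonneg _))
    (hsum.trans (Finset.sum_le_sum fun k hk => ?_))
  · simpa [hf] using hL 0 m.zero_le
  · exact mul_le_mul_of_nonneg_right (hL k (Finset.mem_Icc.1 hk).2) (abs_nonneg _)
end

section
/- Let s ≤ η < e be integers and let (y_t) be the one-change signal y_t = f₁ for s ≤ t ≤ η and y_t = f₂ for η < t ≤ e, with f₁ ≠ f₂. Then the maximizer of the absolute CUSUM is the true change-point: for every b with s ≤ b < e, |Y_{s,e}^b(y)| ≤ |Y_{s,e}^η(y)|, so argmax_{s ≤ b < e} |Y_{s,e}^b(y)| is attained at b = η. -/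
/-- The CUSUM statistic `Y_{s,e}^b(y)` for a real sequence `y` and integers `s ≤ b < e`. -/
noncomputable def cusum (s b e : ℤ) (y : ℤ → ℝ) : ℝ :=
  Real.sqrt ((((b : ℝ) - s + 1) * ((e : ℝ) - b)) / ((e : ℝ) - s + 1)) *
    ((1 / ((b : ℝ) - s + 1)) * ∑ t ∈ Finset.Icc s b, y t -
      (1 / ((e : ℝ) - b)) * ∑ t ∈ Finset.Icc (b + 1) e, y t)

theorem sum_Icc_eq_mul {a c : ℤ} (hac : a ≤ c + 1) {y : ℤ → ℝ} {f : ℝ}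
    (hy : ∀ t ∈ Finset.Icc a c, y t = f) :
    ∑ t ∈ Finset.Icc a c, y t = ((c : ℝ) + 1 - a) * f := by
  have hcard : (((c + 1 - a).toNat : ℤ) : ℝ) = (c : ℝ) + 1 - a := by
    rw [Int.toNat_of_nonneg (by omega)]
    push_cast
    ring
  rw [Finset.sum_congr rfl hy, Finset.sum_const, Int.card_Icc, nsmul_eq_mul, ← hcard,
    Int.cast_natCast]

theorem sum_Icc_add_sum_Icc {a c d : ℤ} (hac : a ≤ c + 1) (hcd : c ≤ d) (y : ℤ → ℝ) :
    ∑ t ∈ Finset.Icc a c, y t + ∑ t ∈ Finset.Icc (c + 1) d, y t =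
      ∑ t ∈ Finset.Icc a d, y t := by
  rw [← Finset.sum_union]
  · congr 1
    ext t
    simp only [Finset.mem_union, Finset.mem_Icc]
    omega
  · rw [Finset.disjoint_left]
    intro t
    simp only [Finset.mem_Icc]
    omega

/-- The squared CUSUM of a one-change signal to the left of the change-point. -/
theorem cusum_sq_of_le {s b η e : ℤ} (hsb : s ≤ b) (hbη : b ≤ η) (hηe : η < e)
    {y : ℤ → ℝ} {f₁ f₂ : ℝ} (hy₁ : ∀ t ∈ Finset.Icc s η, y t = f₁)
    (hy₂ : ∀ t ∈ Finset.Icc (η + 1) e, y t = f₂) :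
    cusum s b e y ^ 2 = ((b : ℝ) - s + 1) * ((e : ℝ) - η) ^ 2 /
      (((e : ℝ) - b) * ((e : ℝ) - s + 1)) * (f₁ - f₂) ^ 2 := by
  have hsb' : (s : ℝ) ≤ b := by exact_mod_cast hsb
  have hbη' : (b : ℝ) ≤ η := by exact_mod_cast hbη
  have hηe' : (η : ℝ) < e := by exact_mod_cast hηe
  have hm : 0 < (b : ℝ) - s + 1 := by linarith
  have hk : 0 < (e : ℝ) - b := by linarith
  have hn : 0 < (e : ℝ) - s + 1 := by linarith
  have h₁ : ∀ t ∈ Finset.Icc s b, y t = f₁ := fun t ht =>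
    hy₁ t (Finset.Icc_subset_Icc_right hbη ht)
  have h₂ : ∀ t ∈ Finset.Icc (b + 1) η, y t = f₁ := fun t ht =>
    hy₁ t (Finset.Icc_subset_Icc_left (by omega) ht)
  rw [cusum, mul_pow, Real.sq_sqrt (by positivity), sum_Icc_eq_mul (by omega) h₁,
    ← sum_Icc_add_sum_Icc (c := η) (by omega) hηe.le, sum_Icc_eq_mul (by omega) h₂,
    sum_Icc_eq_mul (by omega) hy₂]
  push_cast
  field_simp
  ring

/-- The squared CUSUM of a one-change signal to the right of the change-point. -/
theorem cusum_sq_of_ge {s b η e : ℤ} (hsη : s ≤ η) (hηb : η ≤ b) (hbe : b < e)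
    {y : ℤ → ℝ} {f₁ f₂ : ℝ} (hy₁ : ∀ t ∈ Finset.Icc s η, y t = f₁)
    (hy₂ : ∀ t ∈ Finset.Icc (η + 1) e, y t = f₂) :
    cusum s b e y ^ 2 = ((e : ℝ) - b) * ((η : ℝ) - s + 1) ^ 2 /
      (((b : ℝ) - s + 1) * ((e : ℝ) - s + 1)) * (f₁ - f₂) ^ 2 := by
  have hsη' : (s : ℝ) ≤ η := by exact_mod_cast hsη
  have hηb' : (η : ℝ) ≤ b := by exact_mod_cast hηb
  have hbe' : (b : ℝ) < e := by exact_mod_cast hbe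
  have hm : 0 < (b : ℝ) - s + 1 := by linarith
  have hk : 0 < (e : ℝ) - b := by linarith
  have hn : 0 < (e : ℝ) - s + 1 := by linarith
  have h₁ : ∀ t ∈ Finset.Icc (η + 1) b, y t = f₂ := fun t ht =>
    hy₂ t (Finset.Icc_subset_Icc_right hbe.le ht)
  have h₂ : ∀ t ∈ Finset.Icc (b + 1) e, y t = f₂ := fun t ht =>
    hy₂ t (Finset.Icc_subset_Icc_left (by omega) ht)
  rw [cusum, mul_pow, Real.sq_sqrt (by positivity), sum_Icc_eq_mul (by omega) h₂,
    ← sum_Icc_add_sum_Icc (c := η) (by omega) hηb, sum_Icc_eq_mul (by omega) h₁,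
    sum_Icc_eq_mul (by omega) hy₁]
  push_cast
  field_simp
  ring


/-- For the one-change signal `y t = f₁` on `s ≤ t ≤ η` and `y t = f₂` on `η < t ≤ e`
with `f₁ ≠ f₂`, the maximizer of the absolute CUSUM is the true change-point:
`|Y_{s,e}^b(y)| ≤ |Y_{s,e}^η(y)|` for every `s ≤ b < e`, so
`argmax_{s ≤ b < e} |Y_{s,e}^b(y)|` is attained at `b = η`. -/
theorem cusum_one_change_argmax (s η e : ℤ) (hsη : s ≤ η) (hηe : η < e)
    (y : ℤ → ℝ) (f₁ f₂ : ℝ) (hf : f₁ ≠ f₂)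
    (hy₁ : ∀ t ∈ Finset.Icc s η, y t = f₁)
    (hy₂ : ∀ t ∈ Finset.Icc (η + 1) e, y t = f₂) :
    ∀ b : ℤ, s ≤ b → b < e → |cusum s b e y| ≤ |cusum s η e y| := by
  intro b hsb hbe
  have hsη' : (s : ℝ) ≤ η := by exact_mod_cast hsη
  have hηe' : (η : ℝ) < e := by exact_mod_cast hηe
  have hsb' : (s : ℝ) ≤ b := by exact_mod_cast hsb
  have hbe' : (b : ℝ) < e := by exact_mod_cast hbe
  have hm : 0 < (b : ℝ) - s + 1 := by linarith
  have hk : 0 < (e : ℝ) - b := by linarith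
  have hp : 0 < (η : ℝ) - s + 1 := by linarith
  have hq : 0 < (e : ℝ) - η := by linarith
  have hn : 0 < (e : ℝ) - s + 1 := by linarith
  rw [← sq_le_sq]
  rcases le_total b η with hbη | hηb
  · have hbη' : (b : ℝ) ≤ η := by exact_mod_cast hbη
    rw [cusum_sq_of_le hsb hbη hηe hy₁ hy₂, cusum_sq_of_le hsη le_rfl hηe hy₁ hy₂]
    refine mul_le_mul_of_nonneg_right ?_ (sq_nonneg _)
    gcongr
  · have hηb' : (η : ℝ) ≤ b := by exact_mod_cast hηb
    rw [cusum_sq_of_ge hsη hηb hbe hy₁ hy₂, cusum_sq_of_ge hsη le_rfl hηe hy₁ hy₂]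
    refine mul_le_mul_of_nonneg_right ?_ (sq_nonneg _)
    gcongr
end
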